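/- arXiv:2210.17021 — 3 statements merged into one kernel-verified Lean document; each statement's English description precedes it below -/
import Mathlib

section
/- Let n ≥ 1, let C be a nonempty finite set of nonempty words with letters in {1,…,n}, and fix i with 1 ≤ i ≤ |C|. Consider states (α, j) where α is a nonempty word and j ∈ ℕ, and the following transition rules, where m = #prefix_C(α), α' denotes α with its last letter increased by 1, and α'' denotes α with the letter 1 appended: (1) if i > j + m, then (α, j) → (α', j + m); (2) if i ≤ j + m and α ∉ C, then (α, j) → (α'', j); (3) if i ≤ j + m, α ∈ C and i ≠ j + 1, then (α, j) → (α'', j + 1); (4) if α ∈ C and i = j + 1, the state is terminal. Then, starting from the state ((1), 0), finitely many applications of rules (1)–(3) reach a terminal state (α, j) as in rule (4), and its word α is the i-th smallest element of C in lexicographic order. -/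
/-- `v` is lexicographically less than or equal to `w`. -/
def lexLe (v w : List ℕ) : Prop := List.Lex (· < ·) v w ∨ v = w

/-- The number of words in `C` having `β` as a (not necessarily proper) prefix. -/
def prefixCount (C : Finset (List ℕ)) (β : List ℕ) : ℕ :=
  (C.filter fun w => β <+: w).card

/-- One application of rules (1)–(3) on states `(α, j)`. -/
def Step (C : Finset (List ℕ)) (i : ℕ) (s t : List ℕ × ℕ) : Prop :=
  -- rule (1): increment the last letter
  (i > s.2 + prefixCount C s.1 ∧
      ∃ β a, s.1 = β ++ [a] ∧ t = (β ++ [a + 1], s.2 + prefixCount C s.1)) ∨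
  -- rule (2): append the letter 1
  (i ≤ s.2 + prefixCount C s.1 ∧ s.1 ∉ C ∧ t = (s.1 ++ [1], s.2)) ∨
  -- rule (3): append the letter 1 and increment the index
  (i ≤ s.2 + prefixCount C s.1 ∧ s.1 ∈ C ∧ i ≠ s.2 + 1 ∧ t = (s.1 ++ [1], s.2 + 1))

/-- Words below `β ++ [a+1]` are those below `β ++ [a]` or extending it. -/
lemma lex_succ (β : List ℕ) (a : ℕ) (v : List ℕ) :
    List.Lex (· < ·) v (β ++ [a + 1]) ↔ (List.Lex (· < ·) v (β ++ [a]) ∨ β ++ [a] <+: v) := by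
  induction β generalizing v with
  | nil =>
    cases v with
    | nil => simp
    | cons x v =>
      simp only [List.nil_append, List.cons_lex_cons_iff, List.cons_prefix_cons,
        List.nil_prefix, List.not_lex_nil, and_true, and_false, or_false]
      omega
  | cons b β ih =>
    cases v with
    | nil => simp
    | cons x v =>
      simp only [List.cons_append, List.cons_lex_cons_iff, List.cons_prefix_cons, ih]
      constructor <;> grind

lemma not_lex_of_prefix (α v : List ℕ) (h : α <+: v) : ¬ List.Lex (· < ·) v α := by
  induction α generalizing v with
  | nil => simp
  | cons b β ih =>
    cases v with
    | nil => simp at h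
    | cons x v =>
      simp only [List.cons_prefix_cons] at h
      simp only [List.cons_lex_cons_iff]
      have := ih v h.2
      rintro (h' | h')
      · omega
      · exact this h'.2

lemma lex_append_one (α v : List ℕ) (hv : ∀ x ∈ v, 1 ≤ x) :
    List.Lex (· < ·) v (α ++ [1]) ↔ (List.Lex (· < ·) v α ∨ v = α) := by
  induction α generalizing v with
  | nil =>
    cases v with
    | nil => simp
    | cons x v =>
      have := hv x (by simp)
      simp [List.cons_lex_cons_iff]
      omega
  | cons b β ih =>
    cases v with
    | nil => simp
    | cons x v =>
      have := ih v (fun y hy => hv y (by simp [hy]))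
      simp only [List.cons_append, List.cons_lex_cons_iff, this, List.cons.injEq]
      grind

lemma prefix_iff_rest (α v : List ℕ) (hv : ∀ x ∈ v, 1 ≤ x) :
    α <+: v ↔ ((∃ c r, v = α ++ c :: r ∧ 1 ≤ c) ∨ v = α) := by
  constructor
  · rintro ⟨t, rfl⟩
    cases t with
    | nil => simp
    | cons c r => exact Or.inl ⟨c, r, rfl, hv c (by simp)⟩
  · rintro (⟨c, r, rfl, -⟩ | rfl) <;> simp

lemma rest_succ (β : List ℕ) (a : ℕ) (v : List ℕ) :
    (∃ c r, v = β ++ c :: r ∧ a ≤ c) ↔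
      (β ++ [a] <+: v ∨ ∃ c r, v = β ++ c :: r ∧ a + 1 ≤ c) := by
  constructor
  · rintro ⟨c, r, rfl, h⟩
    rcases h.eq_or_lt with rfl | h
    · left; exact ⟨r, by simp⟩
    · right; exact ⟨c, r, rfl, h⟩
  · rintro (⟨r, rfl⟩ | ⟨c, r, rfl, h⟩)
    · exact ⟨a, r, by simp, le_rfl⟩
    · exact ⟨c, r, rfl, by omega⟩

lemma not_rest_succ (β : List ℕ) (a : ℕ) (v : List ℕ) (h : β ++ [a] <+: v) :
    ¬ ∃ c r, v = β ++ c :: r ∧ a + 1 ≤ c := by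
  rintro ⟨c, r, rfl, h'⟩
  obtain ⟨t, ht⟩ := h
  simp at ht
  omega

lemma card_filter_split (C : Finset (List ℕ)) (p q r : List ℕ → Prop)
    [DecidablePred p] [DecidablePred q] [DecidablePred r]
    (h : ∀ v ∈ C, (p v ↔ (q v ∨ r v))) (hd : ∀ v, q v → ¬ r v) :
    (C.filter p).card = (C.filter q).card + (C.filter r).card := by
  rw [← Finset.card_union_of_disjoint]
  · congr 1
    ext v
    simp only [Finset.mem_filter, Finset.mem_union]
    constructor
    · rintro ⟨a, b⟩; have := (h v a).1 b; tauto
    · rintro (⟨a, b⟩ | ⟨a, b⟩)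
      · exact ⟨a, (h v a).2 (Or.inl b)⟩
      · exact ⟨a, (h v a).2 (Or.inr b)⟩
  · rw [Finset.disjoint_filter]
    exact fun v _ => hd v

open scoped Classical in
lemma card_filter_eq (C : Finset (List ℕ)) (α : List ℕ) :
    (C.filter fun v => v = α).card = if α ∈ C then 1 else 0 := by
  rw [Finset.filter_eq']
  split_ifs <;> simp

open scoped Classical in
lemma prefixCount_eq (C : Finset (List ℕ)) (α : List ℕ) :
    prefixCount C α = (C.filter fun v => α <+: v).card := by
  unfold prefixCount
  congr

open scoped Classical in
lemma main_aux (n L : ℕ) (C : Finset (List ℕ))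
    (hwords : ∀ w ∈ C, ∀ x ∈ w, 1 ≤ x ∧ x ≤ n) (hL : ∀ w ∈ C, w.length ≤ L)
    (i : ℕ) (k : ℕ) : ∀ (β : List ℕ) (a j : ℕ), (L - β.length) * (n + 1) + (n - a) ≤ k →
      j = (C.filter fun v => List.Lex (· < ·) v (β ++ [a])).card → j < i →
      i ≤ j + (C.filter fun v => ∃ c r, v = β ++ c :: r ∧ a ≤ c).card →
      ∃ s : List ℕ × ℕ, Relation.ReflTransGen (Step C i) (β ++ [a], j) s ∧
      s.1 ∈ C ∧ i = s.2 + 1 ∧ (C.filter fun v => lexLe v s.1).card = i := by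
  induction k using Nat.strong_induction_on with
  | _ k ih =>
  intro β a j hk hj hji hi
  have hpos : ∀ w ∈ C, ∀ x ∈ w, 1 ≤ x := fun w hw x hx => (hwords w hw x hx).1
  obtain ⟨v, hv⟩ : (C.filter fun v => ∃ c r, v = β ++ c :: r ∧ a ≤ c).Nonempty := by
    rw [← Finset.card_pos]; omega
  rw [Finset.mem_filter] at hv
  obtain ⟨hvC, c, r, hvc, hac⟩ := hv
  have han : a ≤ n := hac.trans (hwords v hvC c (by simp [hvc])).2
  have hβ : β.length < L := by
    have := hL v hvC
    simp [hvc] at this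
    omega
  have hself : (C.filter fun v => lexLe v (β ++ [a])).card
      = j + if β ++ [a] ∈ C then 1 else 0 := by
    rw [hj, ← card_filter_eq]
    apply card_filter_split
    · intro v _; rfl
    · rintro v h rfl
      exact not_lex_of_prefix _ _ (List.prefix_refl _) h
  have hone : (C.filter fun v => List.Lex (· < ·) v (β ++ [a] ++ [1])).card
      = j + if β ++ [a] ∈ C then 1 else 0 := by
    rw [← hself]
    congr 1
    apply Finset.filter_congr
    intro v hv
    exact lex_append_one _ _ (hpos v hv)
  have hpre : prefixCount C (β ++ [a]) =
      (C.filter fun v => ∃ c r, v = β ++ [a] ++ c :: r ∧ 1 ≤ c).card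
        + if β ++ [a] ∈ C then 1 else 0 := by
    rw [prefixCount_eq, ← card_filter_eq]
    apply card_filter_split
    · intro v hv
      exact prefix_iff_rest _ _ (hpos v hv)
    · rintro v ⟨c, r, h, -⟩ rfl
      simp at h
  have hmeas : (L - (β ++ [a]).length) * (n + 1) + (n - 1) < k := by
    obtain ⟨d, rfl⟩ : ∃ d, L = β.length + 1 + d := ⟨L - (β.length + 1), by omega⟩
    have e1 : β.length + 1 + d - (β ++ [a]).length = d := by simp
    have e2 : β.length + 1 + d - β.length = d + 1 := by omega
    rw [e1]; rw [e2, Nat.add_mul] at hk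
    omega
  by_cases h1 : i > j + prefixCount C (β ++ [a])
  · have hA : (C.filter fun v => List.Lex (· < ·) v (β ++ [a + 1])).card
        = j + prefixCount C (β ++ [a]) := by
      rw [hj, prefixCount_eq]
      apply card_filter_split
      · intro v _; exact lex_succ β a v
      · intro v h h'; exact not_lex_of_prefix _ _ h' h
    have hR : (C.filter fun v => ∃ c r, v = β ++ c :: r ∧ a ≤ c).card =
        prefixCount C (β ++ [a]) +
          (C.filter fun v => ∃ c r, v = β ++ c :: r ∧ a + 1 ≤ c).card := by
      rw [prefixCount_eq]
      apply card_filter_split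
      · intro v _; exact rest_succ β a v
      · intro v h; exact not_rest_succ β a v h
    have hi' : i ≤ j + prefixCount C (β ++ [a]) +
        (C.filter fun v => ∃ c r, v = β ++ c :: r ∧ a + 1 ≤ c).card := by omega
    have han' : a + 1 ≤ n := by
      obtain ⟨v, hv⟩ : (C.filter fun v => ∃ c r, v = β ++ c :: r ∧ a + 1 ≤ c).Nonempty := by
        rw [← Finset.card_pos]; omega
      rw [Finset.mem_filter] at hv
      obtain ⟨hvC, c, r, hvc, hac⟩ := hv
      exact hac.trans (hwords v hvC c (by simp [hvc])).2
    obtain ⟨s, hs, hs'⟩ := ih ((L - β.length) * (n + 1) + (n - (a + 1))) (by omega) β (a + 1)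
      (j + prefixCount C (β ++ [a])) le_rfl hA.symm h1 hi'
    exact ⟨s, Relation.ReflTransGen.head (Or.inl ⟨h1, β, a, rfl, rfl⟩) hs, hs'⟩
  · have h1' : i ≤ j + prefixCount C (β ++ [a]) := by omega
    by_cases hC : β ++ [a] ∈ C
    · rw [if_pos hC] at hself hone hpre
      by_cases hij : i = j + 1
      · exact ⟨(β ++ [a], j), Relation.ReflTransGen.refl, hC, hij, by rw [hself, hij]⟩
      · obtain ⟨s, hs, hs'⟩ := ih _ hmeas (β ++ [a]) 1 (j + 1) le_rfl hone.symm (by omega)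
          (by omega)
        exact ⟨s, Relation.ReflTransGen.head (Or.inr (Or.inr ⟨h1', hC, hij, rfl⟩)) hs, hs'⟩
    · rw [if_neg hC] at hself hone hpre
      obtain ⟨s, hs, hs'⟩ := ih _ hmeas (β ++ [a]) 1 j le_rfl hone.symm (by omega)
          (by omega)
      exact ⟨s, Relation.ReflTransGen.head (Or.inr (Or.inl ⟨h1', hC, rfl⟩)) hs, hs'⟩

open scoped Classical in
theorem stmt0 (n : ℕ) (hn : 1 ≤ n) (C : Finset (List ℕ)) (hne : C.Nonempty)
    (hwords : ∀ w ∈ C, w ≠ [] ∧ ∀ x ∈ w, x ∈ Finset.Icc 1 n)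
    (i : ℕ) (hi : 1 ≤ i) (hiC : i ≤ C.card) :
    ∃ s : List ℕ × ℕ, Relation.ReflTransGen (Step C i) ([1], 0) s ∧
      -- `s` is terminal as in rule (4)
      s.1 ∈ C ∧ i = s.2 + 1 ∧
      -- and its word is the `i`-th smallest element of `C` in lexicographic order
      (C.filter fun v => lexLe v s.1).card = i := by
  have hw : ∀ w ∈ C, ∀ x ∈ w, 1 ≤ x ∧ x ≤ n := fun w hw x hx =>
    Finset.mem_Icc.1 ((hwords w hw).2 x hx)
  refine main_aux n (C.sup List.length) C hw (fun w hw => Finset.le_sup (f := List.length) hw) i _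
    [] 1 0 le_rfl ?_ (by omega) ?_
  · symm
    rw [Finset.card_eq_zero, Finset.filter_eq_empty_iff]
    intro v hv h
    rw [lex_append_one [] v (fun x hx => (hw v hv x hx).1)] at h
    rcases h with h | h
    · simp at h
    · exact (hwords v hv).1 h
  · rw [Finset.filter_true_of_mem]
    · omega
    · intro v hv
      cases v with
      | nil => exact absurd rfl (hwords _ hv).1
      | cons c r => exact ⟨c, r, rfl, (hw _ hv c (by simp)).1⟩
end

section
/- Let C be a finite set of words and let α be a word. Set j = |{v ∈ C : v < α in lexicographic order}| and m = #prefix_C(α). Then for every w ∈ C, α is a prefix of w if and only if j < |{v ∈ C : v ≤ w in lexicographic order}| ≤ j + m. In particular, the words of C having prefix α occupy exactly the positions j+1, …, j+m in the lexicographically sorted listing of C. -/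
theorem lex_aux1 (α w : List ℕ) (h : α <+: w) : ¬ List.Lex (· < ·) w α := by
  induction α generalizing w with
  | nil => intro h'; cases h'
  | cons a t ih =>
    cases w with
    | nil => simp at h
    | cons b s =>
      rw [List.cons_prefix_cons] at h
      obtain ⟨rfl, h⟩ := h
      rw [List.lex_cons_iff]
      exact ih s h

theorem lex_aux2 (α v w : List ℕ) (h : α <+: w) (hv : List.Lex (· < ·) v w)
    (hn : ¬ List.Lex (· < ·) v α) : α <+: v := by
  induction α generalizing v w with
  | nil => simp
  | cons a t ih =>
    cases w with
    | nil => simp at h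
    | cons b s =>
      rw [List.cons_prefix_cons] at h
      obtain ⟨rfl, h⟩ := h
      cases hv with
      | nil => exact absurd List.Lex.nil hn
      | rel h' => exact absurd (List.Lex.rel h') hn
      | cons h' =>
        rw [List.cons_prefix_cons]
        exact ⟨rfl, ih _ s h h' (fun h2 => hn (List.Lex.cons h2))⟩

theorem lex_aux3 (α v w : List ℕ) (hw : ¬ List.Lex (· < ·) w α) (hp : ¬ α <+: w)
    (hv : α <+: v) : List.Lex (· < ·) v w := by
  induction α generalizing v w with
  | nil => simp at hp
  | cons a t ih =>
    cases v with
    | nil => simp at hv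
    | cons b s =>
      rw [List.cons_prefix_cons] at hv
      obtain ⟨rfl, hv⟩ := hv
      cases w with
      | nil => exact absurd List.Lex.nil hw
      | cons c u =>
        rcases lt_trichotomy a c with h | rfl | h
        · exact List.Lex.rel h
        · rw [List.cons_prefix_cons] at hp
          exact List.Lex.cons (ih s u (fun h2 => hw (List.Lex.cons h2))
            (fun h2 => hp ⟨rfl, h2⟩) hv)
        · exact absurd (List.Lex.rel h) hw

theorem lex_aux4 (u v w : List ℕ) (h : List.Lex (· < ·) u v) (h' : List.Lex (· < ·) v w) :
    List.Lex (· < ·) u w :=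
  lt_trans (a := u) (b := v) (c := w) h h'

open scoped Classical in
theorem stmt1 (C : Finset (List ℕ)) (α : List ℕ) :
    ∀ w ∈ C, (α <+: w ↔
      ((C.filter fun v => List.Lex (· < ·) v α).card <
          (C.filter fun v => lexLe v w).card ∧
        (C.filter fun v => lexLe v w).card ≤
          (C.filter fun v => List.Lex (· < ·) v α).card + prefixCount C α)) := by
  intro w hw
  unfold prefixCount
  constructor
  · intro h
    constructor
    · apply Finset.card_lt_card
      rw [Finset.ssubset_iff_of_subset]
      · exact ⟨w, by simp [hw, lexLe], fun h2 => lex_aux1 α w h (Finset.mem_filter.mp h2).2⟩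
      · intro v hv
        rw [Finset.mem_filter] at hv ⊢
        refine ⟨hv.1, ?_⟩
        by_contra hc
        have hlt : List.Lex (· < ·) w v := by
          rcases lt_trichotomy v w with h1 | h1 | h1
          · exact absurd (Or.inl h1) hc
          · exact absurd (Or.inr h1) hc
          · exact h1
        exact lex_aux1 α w h (lex_aux4 _ _ _ hlt hv.2)
    · refine le_trans (Finset.card_le_card ?_) (Finset.card_union_le _ _)
      intro v hv
      rw [Finset.mem_filter] at hv
      rw [Finset.mem_union, Finset.mem_filter, Finset.mem_filter]
      by_cases hc : List.Lex (· < ·) v α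
      · exact Or.inl ⟨hv.1, hc⟩
      · refine Or.inr ⟨hv.1, ?_⟩
        rcases hv.2 with h1 | rfl
        · exact lex_aux2 α v w h h1 hc
        · exact h
  · rintro ⟨h1, h2⟩
    by_contra hp
    by_cases hc : List.Lex (· < ·) w α
    · refine absurd h1 (not_lt.mpr (Finset.card_le_card ?_))
      intro v hv
      rw [Finset.mem_filter] at hv ⊢
      refine ⟨hv.1, ?_⟩
      rcases hv.2 with h3 | rfl
      · exact lex_aux4 _ _ _ h3 hc
      · exact hc
    · refine absurd h2 (not_le.mpr ?_)
      rw [← Finset.card_union_of_disjoint]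
      · apply Finset.card_lt_card
        rw [Finset.ssubset_iff_of_subset]
        · exact ⟨w, by simp [hw, lexLe], fun h3 => (Finset.mem_union.mp h3).elim
            (fun h4 => hc (Finset.mem_filter.mp h4).2) (fun h4 => hp (Finset.mem_filter.mp h4).2)⟩
        · intro v hv
          rw [Finset.mem_union, Finset.mem_filter, Finset.mem_filter] at hv
          rw [Finset.mem_filter]
          rcases hv with hv | hv
          · exact ⟨hv.1, Or.inl (lex_aux4 _ _ _ hv.2
              (lex_aux3 α α w hc hp (List.prefix_refl α)))⟩
          · exact ⟨hv.1, Or.inl (lex_aux3 α v w hc hp hv.2)⟩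
      · rw [Finset.disjoint_left]
        intro v hv hv'
        rw [Finset.mem_filter] at hv hv'
        exact lex_aux1 α v hv'.2 hv.2
end

section
/- For m ≥ 1, let O_{2m−1} = {(i, i) : 1 ≤ i ≤ m} ∪ {(i, i+1) : 1 ≤ i ≤ m−1} be the odd staircase-shaped board with 2m−1 squares. Then the rook polynomial of O_{2m−1} is the Fibonacci polynomial F_{2m−1}; that is, for every j ≥ 0, r_j(O_{2m−1}) equals the coefficient of x^j in F_{2m−1}(x), which equals the binomial coefficient C(2m−j, j). -/
/-- `rookCount B k` is the number of placements of `k` nonattacking rooks on `B`,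
i.e. `k`-element subsets of `B` in which no two squares share a row or a column. -/
def rookCount (B : Finset (ℕ × ℕ)) (k : ℕ) : ℕ :=
  ((B.powersetCard k).filter (fun S => ∀ p ∈ S, ∀ q ∈ S, (p.1 = q.1 ∨ p.2 = q.2) → p = q)).card

/-- The Fibonacci polynomials. -/
noncomputable def fibPoly : ℕ → Polynomial ℕ
  | 0 => 1
  | 1 => 1 + Polynomial.X
  | n + 2 => Polynomial.X * fibPoly n + fibPoly (n + 1)

theorem rookCount_zero (B : Finset (ℕ × ℕ)) : rookCount B 0 = 1 := by
  simp [rookCount, Finset.filter_singleton]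

theorem rookCount_insert (B : Finset (ℕ × ℕ)) (a : ℕ × ℕ) (ha : a ∉ B) (k : ℕ) :
    rookCount (insert a B) (k + 1) = rookCount B (k + 1) +
      rookCount (B.filter fun p => ¬ (p.1 = a.1 ∨ p.2 = a.2)) k := by
  unfold rookCount
  rw [Finset.powersetCard_succ_insert ha, Finset.filter_union, Finset.card_union_of_disjoint]
  · congr 1
    symm
    apply Finset.card_bij (fun S _ => insert a S)
    · intro S hS
      simp only [Finset.mem_filter, Finset.mem_powersetCard, Finset.mem_image] at hS ⊢
      obtain ⟨⟨h1, h2⟩, h3⟩ := hS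
      have h4 : ∀ p ∈ S, p ∈ B ∧ ¬ (p.1 = a.1 ∨ p.2 = a.2) := fun p hp => by
        simpa using h1 hp
      refine ⟨⟨S, ⟨fun p hp => (h4 p hp).1, h2⟩, rfl⟩, ?_⟩
      intro p hp q hq hpq
      rcases Finset.mem_insert.1 hp with rfl | hp2 <;> rcases Finset.mem_insert.1 hq with rfl | hq2
      · rfl
      · exact absurd (hpq.imp Eq.symm Eq.symm) (h4 q hq2).2
      · exact absurd hpq (h4 p hp2).2
      · exact h3 p hp2 q hq2 hpq
    · intro S hS T hT h
      simp only [Finset.mem_filter, Finset.mem_powersetCard] at hS hT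
      have hS' : a ∉ S := fun h => ha (Finset.mem_filter.1 (hS.1.1 h)).1
      have hT' : a ∉ T := fun h => ha (Finset.mem_filter.1 (hT.1.1 h)).1
      rw [← Finset.erase_insert hS', ← Finset.erase_insert hT', h]
    · intro T hT
      simp only [Finset.mem_filter, Finset.mem_powersetCard, Finset.mem_image] at hT
      obtain ⟨⟨S, ⟨h1, h2⟩, rfl⟩, h3⟩ := hT
      refine ⟨S, ?_, rfl⟩
      simp only [Finset.mem_filter, Finset.mem_powersetCard]
      refine ⟨⟨fun p hp => ?_, h2⟩, fun p hp q hq => h3 p (Finset.mem_insert_of_mem hp) q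
        (Finset.mem_insert_of_mem hq)⟩
      refine Finset.mem_filter.2 ⟨h1 hp, fun h => ?_⟩
      have := h3 p (Finset.mem_insert_of_mem hp) a (Finset.mem_insert_self _ _) h
      subst this
      exact ha (h1 hp)
  · rw [Finset.disjoint_left]
    intro S hS hT
    simp only [Finset.mem_filter, Finset.mem_powersetCard, Finset.mem_image] at hS hT
    obtain ⟨⟨T, _, rfl⟩, _⟩ := hT
    exact ha (hS.1.1 (Finset.mem_insert_self _ _))

/-- The squares of the staircase, in order. -/
def stairSq (n : ℕ) : ℕ × ℕ := (n / 2 + 1, (n + 1) / 2 + 1)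

/-- The first `n` squares of the staircase. -/
def stair (n : ℕ) : Finset (ℕ × ℕ) := (Finset.range n).image stairSq

theorem stair_succ (n : ℕ) : stair (n + 1) = insert (stairSq n) (stair n) := by
  simp [stair, Finset.range_add_one, Finset.image_insert]

theorem stairSq_notMem (n : ℕ) : stairSq n ∉ stair n := by
  simp only [stair, stairSq, Finset.mem_image, Finset.mem_range, Prod.mk.injEq]
  rintro ⟨i, hi, h1, h2⟩
  omega

theorem stair_filter (n : ℕ) : ((stair (n + 1)).filter
    fun p => ¬ (p.1 = (stairSq (n + 1)).1 ∨ p.2 = (stairSq (n + 1)).2)) = stair n := by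
  ext p
  simp only [stair, Finset.mem_filter, Finset.mem_image, Finset.mem_range]
  constructor
  · rintro ⟨⟨i, hi, rfl⟩, h⟩
    refine ⟨i, ?_, rfl⟩
    simp only [stairSq] at h
    omega
  · rintro ⟨i, hi, rfl⟩
    refine ⟨⟨i, by omega, rfl⟩, ?_⟩
    simp only [stairSq]
    omega

theorem rook_stair_rec (n k : ℕ) : rookCount (stair (n + 2)) (k + 1) =
    rookCount (stair (n + 1)) (k + 1) + rookCount (stair n) k := by
  rw [stair_succ (n + 1), rookCount_insert _ _ (stairSq_notMem _), stair_filter]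

theorem rook_empty (k : ℕ) : rookCount ∅ (k + 1) = 0 := by
  simp [rookCount]

theorem rook_stair_one (k : ℕ) : rookCount (stair 1) (k + 1) = if k = 0 then 1 else 0 := by
  have h0 : stair 0 = ∅ := by simp [stair]
  rw [stair_succ 0, rookCount_insert _ _ (stairSq_notMem _), h0, rook_empty, Finset.filter_empty]
  cases k with
  | zero => simp [rookCount_zero]
  | succ k => simp [rook_empty]

theorem fib_coeff_zero (n : ℕ) : (fibPoly n).coeff 0 = 1 := by
  induction n using Nat.twoStepInduction with
  | zero => simp [fibPoly]
  | one => simp [fibPoly]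
  | more n _ ih => simp [fibPoly, ih]

theorem rook_stair_fib (n : ℕ) : ∀ j, rookCount (stair n) j = (fibPoly n).coeff j := by
  induction n using Nat.twoStepInduction with
  | zero =>
    intro j
    cases j with
    | zero => rw [rookCount_zero, fib_coeff_zero]
    | succ k => simp [stair, rook_empty, fibPoly, Polynomial.coeff_one]
  | one =>
    intro j
    cases j with
    | zero => rw [rookCount_zero, fib_coeff_zero]
    | succ k =>
      rw [rook_stair_one]
      simp [fibPoly, Polynomial.coeff_one, Polynomial.coeff_X, eq_comm]
  | more n ih1 ih2 =>
    intro j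
    cases j with
    | zero => rw [rookCount_zero, fib_coeff_zero]
    | succ k =>
      rw [rook_stair_rec, ih1, ih2, fibPoly, Polynomial.coeff_add, Polynomial.coeff_X_mul, add_comm]

theorem rook_stair_choose (n : ℕ) : ∀ j, rookCount (stair n) j = (n + 1 - j).choose j := by
  induction n using Nat.twoStepInduction with
  | zero =>
    intro j
    cases j with
    | zero => simp [rookCount_zero]
    | succ k => simp [stair, rook_empty]
  | one =>
    intro j
    cases j with
    | zero => simp [rookCount_zero]
    | succ k =>
      rw [rook_stair_one]
      cases k with
      | zero => simp
      | succ k =>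
        rw [Nat.choose_eq_zero_of_lt (by omega)]
        simp
  | more n ih1 ih2 =>
    intro j
    cases j with
    | zero => simp [rookCount_zero]
    | succ k =>
      rw [rook_stair_rec, ih1, ih2]
      by_cases h : k ≤ n + 1
      · obtain ⟨d, hd⟩ := Nat.exists_eq_add_of_le h
        have e1 : n + 1 + 1 - (k + 1) = d := by omega
        have e2 : n + 1 - k = d := by omega
        have e3 : n + 2 + 1 - (k + 1) = d + 1 := by omega
        rw [e1, e2, e3, Nat.choose_succ_succ, add_comm]
      · rw [Nat.choose_eq_zero_of_lt (by omega), Nat.choose_eq_zero_of_lt (by omega),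
          Nat.choose_eq_zero_of_lt (by omega)]

theorem board_eq_stair (m : ℕ) (hm : 1 ≤ m) :
    ((Finset.Icc 1 m).image fun i => (i, i)) ∪
      ((Finset.Icc 1 (m - 1)).image fun i => (i, i + 1)) = stair (2 * m - 1) := by
  ext ⟨a, b⟩
  simp only [stair, stairSq, Finset.mem_union, Finset.mem_image, Finset.mem_Icc, Finset.mem_range,
    Prod.mk.injEq]
  constructor
  · rintro (⟨i, hi, rfl, rfl⟩ | ⟨i, hi, rfl, rfl⟩)
    · exact ⟨2 * i - 2, by omega, by omega, by omega⟩
    · exact ⟨2 * i - 1, by omega, by omega, by omega⟩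
  · rintro ⟨i, hi, rfl, rfl⟩
    rcases Nat.even_or_odd' i with ⟨c, rfl | rfl⟩
    · exact Or.inl ⟨c + 1, by omega, by omega, by omega⟩
    · exact Or.inr ⟨c + 1, by omega, by omega, by omega⟩

theorem stmt12 (m : ℕ) (hm : 1 ≤ m) :
    ∀ j : ℕ,
      rookCount (((Finset.Icc 1 m).image fun i => (i, i)) ∪
          ((Finset.Icc 1 (m - 1)).image fun i => (i, i + 1))) j =
        (fibPoly (2 * m - 1)).coeff j ∧
      rookCount (((Finset.Icc 1 m).image fun i => (i, i)) ∪
          ((Finset.Icc 1 (m - 1)).image fun i => (i, i + 1))) j =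
        (2 * m - j).choose j := by
  intro j
  rw [board_eq_stair m hm]
  refine ⟨rook_stair_fib _ j, ?_⟩
  rw [rook_stair_choose, show 2 * m - 1 + 1 = 2 * m by omega]
end
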